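/- Let θ ∈ (0,1), y* = (1−θ, θ)ᵀ, and let g : ℝ²_{>0} → ℝ²_{>0} be twice continuously differentiable with g(c·y*) = c·y* for all c > 0 and g₁(y) + g₂(y) = y₁ + y₂ for all y ∈ ℝ²_{>0}. If the method generated by g does not overshoot the steady state of the test problem (i.e. for every ε ∈ (0,1) with ε < θ, g((1−ε,ε)ᵀ)₂ < θ and g((1−ε,ε)ᵀ)₁ > 1−θ, and the reversed strict inequalities hold for ε > θ), then R := tr(Dg(y*)) − 1 ≥ 0. -/

import Mathlib

/-- (Contrapositive of the main theorem.) If the method generated by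
`g` does not overshoot the steady state `y* = (1−θ, θ)ᵀ` of the test problem, then
the stability value `R = tr Dg(y*) − 1` is nonnegative. -/
theorem nonneg_stability_of_no_overshoot
    (θ : ℝ) (hθ : θ ∈ Set.Ioo (0 : ℝ) 1)
    (g : (Fin 2 → ℝ) → (Fin 2 → ℝ))
    (hmap : ∀ y : Fin 2 → ℝ, 0 < y 0 → 0 < y 1 → 0 < g y 0 ∧ 0 < g y 1)
    (hsmooth : ContDiffOn ℝ 2 g {y : Fin 2 → ℝ | 0 < y 0 ∧ 0 < y 1})
    (hfix : ∀ c : ℝ, 0 < c → g (c • ![1 - θ, θ]) = c • ![1 - θ, θ])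
    (hcons : ∀ y : Fin 2 → ℝ, 0 < y 0 → 0 < y 1 → g y 0 + g y 1 = y 0 + y 1)
    (hnoovershoot : ∀ ε : ℝ, 0 < ε → ε < 1 →
      (ε < θ → g ![1 - ε, ε] 1 < θ ∧ 1 - θ < g ![1 - ε, ε] 0) ∧
      (θ < ε → θ < g ![1 - ε, ε] 1 ∧ g ![1 - ε, ε] 0 < 1 - θ)) :
    0 ≤ (Matrix.of fun i j =>
      fderiv ℝ g ![1 - θ, θ] (Pi.single j 1) i : Matrix (Fin 2) (Fin 2) ℝ).trace - 1 := by
  obtain ⟨h0, h1⟩ := hθ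
  set p : Fin 2 → ℝ := ![1 - θ, θ] with hp
  have hopen : IsOpen {y : Fin 2 → ℝ | 0 < y 0 ∧ 0 < y 1} :=
    (isOpen_lt continuous_const (continuous_apply 0)).inter
      (isOpen_lt continuous_const (continuous_apply 1))
  have hmem : {y : Fin 2 → ℝ | 0 < y 0 ∧ 0 < y 1} ∈ nhds p :=
    hopen.mem_nhds (by simp [hp, h0, h1])
  have hd : HasFDerivAt g (fderiv ℝ g p) p :=
    ((hsmooth.contDiffAt hmem).differentiableAt (by norm_num)).hasFDerivAt
  have hgp : g p = p := by simpa using hfix 1 one_pos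
  have hd' := hasFDerivAt_pi'.1 hd
  set L := fderiv ℝ g p with hL
  -- conservation
  have hsum := (hd' 0).add (hd' 1)
  have hlin : HasFDerivAt (fun y : Fin 2 → ℝ => y 0 + y 1)
      (ContinuousLinearMap.proj (R := ℝ) (φ := fun _ : Fin 2 => ℝ) 0 +
        ContinuousLinearMap.proj (R := ℝ) (φ := fun _ : Fin 2 => ℝ) 1) p :=
    (hasFDerivAt_apply 0 p).add (hasFDerivAt_apply 1 p)
  have heq : (fun y : Fin 2 → ℝ => y 0 + y 1) =ᶠ[nhds p]
      ((fun y => g y 0) + fun y => g y 1) := by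
    filter_upwards [hmem] with y hy
    exact (hcons y hy.1 hy.2).symm
  have huniq := (hsum.congr_of_eventuallyEq heq).unique hlin
  have hcol : L (Pi.single 0 1) 0 + L (Pi.single 0 1) 1 = 1 := by
    have := DFunLike.congr_fun huniq (Pi.single 0 1)
    simpa using this
  -- derivative along the invariant line
  have hline : HasDerivAt (fun ε : ℝ => (![1 - ε, ε] : Fin 2 → ℝ)) ![-1, 1] θ := by
    rw [hasDerivAt_pi]
    intro i
    fin_cases i
    · simpa using (hasDerivAt_id θ).const_sub 1
    · simpa using hasDerivAt_id' θ
  have hphi : HasDerivAt (fun ε : ℝ => g ![1 - ε, ε] 1) (L ![-1, 1] 1) θ :=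
    HasFDerivAt.comp_hasDerivAt (l := fun y => g y 1)
      (l' := (ContinuousLinearMap.proj 1).comp L) θ (hd' 1) hline
  have hvec : (![-1, 1] : Fin 2 → ℝ) = Pi.single 1 1 - Pi.single 0 1 := by
    ext i
    fin_cases i <;> simp
  have hnn : 0 ≤ L ![-1, 1] 1 := by
    refine ge_of_tendsto (hasDerivAt_iff_tendsto_slope.1 hphi) ?_
    have hI : ∀ᶠ ε in nhdsWithin θ {θ}ᶜ, ε ∈ Set.Ioo (0 : ℝ) 1 :=
      nhdsWithin_le_nhds (Ioo_mem_nhds h0 h1)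
    filter_upwards [hI, self_mem_nhdsWithin] with ε hε hne
    have hv : g ![1 - θ, θ] 1 = θ := by rw [← hp, hgp]; simp [hp]
    rw [slope_def_field, hv]
    rcases lt_or_gt_of_ne (show ε ≠ θ from hne) with h | h
    · have := ((hnoovershoot ε hε.1 hε.2).1 h).1
      exact div_nonneg_of_nonpos (by linarith) (by linarith)
    · have := ((hnoovershoot ε hε.1 hε.2).2 h).1
      exact div_nonneg (by linarith) (by linarith)
  rw [hvec, map_sub, Pi.sub_apply] at hnn
  rw [Matrix.trace_fin_two]
  simp only [Matrix.of_apply]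
  linarith
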